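/- arXiv:1004.2984 — 9 statements merged into one kernel-verified Lean document; each statement's English description precedes it below -/
import Mathlib

section
/- The set ℬ is invariant under the Wainwright–Hsu system: if c : I → ℝ⁶ is a solution of the Wainwright–Hsu system on an interval I and c(t₀) ∈ ℬ for some t₀ ∈ I (i.e. Σ₁+Σ₂+Σ₃ = 0 and Ω = 0 at c(t₀)), then c(t) ∈ ℬ for every t ∈ I; that is, the quantities Σ₁+Σ₂+Σ₃ and Ω are constant along every solution starting in ℬ. -/
noncomputable section

/-- `q = (Σ₁²+Σ₂²+Σ₃²)/3`. Coordinates: `p 0,p 1,p 2 = Σ₁,Σ₂,Σ₃`, `p 3,p 4,p 5 = N₁,N₂,N₃`. -/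
def WHq (p : Fin 6 → ℝ) : ℝ := (p 0 ^ 2 + p 1 ^ 2 + p 2 ^ 2) / 3

/-- The Wainwright–Hsu vector field on ℝ⁶. -/
def WHX (p : Fin 6 → ℝ) : Fin 6 → ℝ :=
  ![(2 - WHq p) * p 0
      - (2 * p 3 ^ 2 - p 4 ^ 2 - p 5 ^ 2 + 2 * p 4 * p 5 - p 3 * p 4 - p 3 * p 5) / 3,
    (2 - WHq p) * p 1
      - (2 * p 4 ^ 2 - p 5 ^ 2 - p 3 ^ 2 + 2 * p 5 * p 3 - p 4 * p 5 - p 4 * p 3) / 3,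
    (2 - WHq p) * p 2
      - (2 * p 5 ^ 2 - p 3 ^ 2 - p 4 ^ 2 + 2 * p 3 * p 4 - p 5 * p 3 - p 5 * p 4) / 3,
    -(WHq p + 2 * p 0) * p 3,
    -(WHq p + 2 * p 1) * p 4,
    -(WHq p + 2 * p 2) * p 5]

/-- `Ω = 6 − (Σ₁²+Σ₂²+Σ₃²) + (1/2)(N₁²+N₂²+N₃²) − (N₁N₂+N₁N₃+N₂N₃)`. -/
def WHOmega (p : Fin 6 → ℝ) : ℝ :=
  6 - (p 0 ^ 2 + p 1 ^ 2 + p 2 ^ 2) + (1 / 2) * (p 3 ^ 2 + p 4 ^ 2 + p 5 ^ 2)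
    - (p 3 * p 4 + p 3 * p 5 + p 4 * p 5)

/-- The phase space ℬ. -/
def WHB : Set (Fin 6 → ℝ) := {p | p 0 + p 1 + p 2 = 0 ∧ WHOmega p = 0}

/-- A solution of a homogeneous linear ODE `f' = a f` with continuous coefficient on an interval
vanishes identically as soon as it vanishes at one point. -/
theorem eqOn_zero_of_hasDerivWithinAt_mul {I : Set ℝ} (hI : I.OrdConnected) {a f : ℝ → ℝ}
    (ha : ContinuousOn a I) (hf : ∀ t ∈ I, HasDerivWithinAt f (a t * f t) I t)
    {t₀ : ℝ} (ht₀ : t₀ ∈ I) (h₀ : f t₀ = 0) : ∀ t ∈ I, f t = 0 := by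
  intro t ht
  have hsub : Set.uIcc t₀ t ⊆ I := hI.uIcc_subset ht₀ ht
  obtain ⟨K, hK⟩ := isCompact_uIcc.exists_bound_of_continuousOn (ha.mono hsub)
  have hlip : ∀ s ∈ Set.uIcc t₀ t,
      LipschitzOnWith K.toNNReal (fun x => a s * x) Set.univ := by
    intro s hs
    refine LipschitzOnWith.of_dist_le_mul fun x _ y _ => ?_
    rw [Real.dist_eq, Real.dist_eq, ← mul_sub, abs_mul]
    exact mul_le_mul_of_nonneg_right ((hK s hs).trans (Real.le_coe_toNNReal K)) (abs_nonneg _)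
  have hcont : ContinuousOn f (Set.uIcc t₀ t) := fun s hs =>
    ((hf s (hsub hs)).continuousWithinAt).mono hsub
  have hzero : ∀ (s : ℝ) (S : Set ℝ),
      HasDerivWithinAt (fun _ : ℝ => (0 : ℝ)) (a s * 0) S s := fun s S => by
    simpa using hasDerivWithinAt_const s S (0 : ℝ)
  rcases le_total t₀ t with h | h
  · rw [Set.uIcc_of_le h] at hsub hlip hcont
    refine ODE_solution_unique_of_mem_Icc_right (v := fun s x => a s * x)
      (s := fun _ => Set.univ) (g := fun _ => 0)
      (fun s hs => hlip s (Set.Ico_subset_Icc_self hs)) hcont (fun s hs => ?_)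
      (fun _ _ => trivial) continuousOn_const (fun s _ => hzero s _) (fun _ _ => trivial) h₀
      (Set.right_mem_Icc.2 h)
    exact ((hf s (hsub (Set.Ico_subset_Icc_self hs))).mono hsub).mono_of_mem_nhdsWithin
      (Icc_mem_nhdsGE_of_mem hs)
  · rw [Set.uIcc_of_ge h] at hsub hlip hcont
    refine ODE_solution_unique_of_mem_Icc_left (v := fun s x => a s * x)
      (s := fun _ => Set.univ) (g := fun _ => 0)
      (fun s hs => hlip s (Set.Ioc_subset_Icc_self hs)) hcont (fun s hs => ?_)
      (fun _ _ => trivial) continuousOn_const (fun s _ => hzero s _) (fun _ _ => trivial) h₀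
      (Set.left_mem_Icc.2 h)
    exact ((hf s (hsub (Set.Ioc_subset_Icc_self hs))).mono hsub).mono_of_mem_nhdsWithin
      (Icc_mem_nhdsLE_of_mem hs)

/-- The set ℬ is invariant under the Wainwright–Hsu system: if a solution of the
Wainwright–Hsu system on an interval `I` lies in ℬ at some time `t₀ ∈ I`, then it lies
in ℬ at every time `t ∈ I`. -/
theorem WHB_invariant (I : Set ℝ) (hI : I.OrdConnected) (c : ℝ → (Fin 6 → ℝ))
    (hc : ∀ t ∈ I, HasDerivWithinAt c (WHX (c t)) I t)
    (t₀ : ℝ) (ht₀ : t₀ ∈ I) (h₀ : c t₀ ∈ WHB) :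
    ∀ t ∈ I, c t ∈ WHB := by
  have hcoord : ∀ t ∈ I, ∀ i, HasDerivWithinAt (fun s => c s i) (WHX (c t) i) I t :=
    fun t ht => hasDerivWithinAt_pi.1 (hc t ht)
  have hcc : ∀ i, ContinuousOn (fun s => c s i) I := fun i t ht =>
    (hcoord t ht i).continuousWithinAt
  have hq : ContinuousOn (fun s => WHq (c s)) I :=
    ((((hcc 0).pow 2).add ((hcc 1).pow 2)).add ((hcc 2).pow 2)).div_const 3
  have hsum : ∀ t ∈ I, c t 0 + c t 1 + c t 2 = 0 := by
    refine eqOn_zero_of_hasDerivWithinAt_mul hI (a := fun s => 2 - WHq (c s))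
      (f := fun s => c s 0 + c s 1 + c s 2) (continuousOn_const.sub hq) (fun t ht => ?_) ht₀ h₀.1
    refine (((hcoord t ht 0).add (hcoord t ht 1)).add (hcoord t ht 2)).congr_deriv ?_
    simp [WHX]
    ring
  have hOmega : ∀ t ∈ I, WHOmega (c t) = 0 := by
    refine eqOn_zero_of_hasDerivWithinAt_mul hI (a := fun s => -2 * WHq (c s))
      (f := fun s => WHOmega (c s)) (continuousOn_const.mul hq) (fun t ht => ?_) ht₀ h₀.2
    have d := hcoord t ht
    have h2 : c t 2 = -c t 0 - c t 1 := by linarith [hsum t ht]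
    have key := (((((d 0).pow 2).add ((d 1).pow 2)).add ((d 2).pow 2)).const_sub 6).add
      (((((d 3).pow 2).add ((d 4).pow 2)).add ((d 5).pow 2)).const_mul (1 / 2)) |>.sub
      ((((d 3).mul (d 4)).add ((d 3).mul (d 5))).add ((d 4).mul (d 5)))
    refine key.congr_deriv ?_
    simp [WHX, WHOmega, WHq, h2]
    ring
  exact fun t ht => ⟨hsum t ht, hOmega t ht⟩
end
end

section
/- Every point of the Kasner circle which is not a Taub point has a unique Kasner parameter: if p ∈ 𝒦 is not one of T₁, T₂, T₃, then there exists a unique u ∈ [1,∞) such that (2+2Σ₁)(2+2Σ₂)(2+2Σ₃) = −216 u²(1+u)² / (1+u+u²)³. -/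
noncomputable section

/-- The Kasner circle 𝒦 in ℝ⁶ (coordinates `p 0,p 1,p 2 = Σ₁,Σ₂,Σ₃`,
`p 3,p 4,p 5 = N₁,N₂,N₃`). -/
def KasnerCircle : Set (Fin 6 → ℝ) :=
  {p | p 0 + p 1 + p 2 = 0 ∧ p 0 ^ 2 + p 1 ^ 2 + p 2 ^ 2 = 6 ∧ p 3 = 0 ∧ p 4 = 0 ∧ p 5 = 0}

/-- `p` is one of the three Taub points `T₁,T₂,T₃`,
with `(Σ₁,Σ₂,Σ₃) = (2,−1,−1), (−1,2,−1), (−1,−1,2)`. -/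
def IsTaub (p : Fin 6 → ℝ) : Prop :=
  (p 0 = 2 ∧ p 1 = -1 ∧ p 2 = -1) ∨ (p 0 = -1 ∧ p 1 = 2 ∧ p 2 = -1) ∨
    (p 0 = -1 ∧ p 1 = -1 ∧ p 2 = 2)

/-- The right-hand side of the Kasner relation is strictly monotone on `[1,∞)`. -/
theorem strictMonoOn_kasner :
    StrictMonoOn (fun u : ℝ => -216 * u ^ 2 * (1 + u) ^ 2 / (1 + u + u ^ 2) ^ 3) (Set.Ici 1) := by
  intro u hu v hv huv
  have hu : 1 ≤ u := hu
  obtain ⟨s, hs⟩ : ∃ s, s = u + u ^ 2 := ⟨_, rfl⟩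
  obtain ⟨t, ht⟩ : ∃ t, t = v + v ^ 2 := ⟨_, rfl⟩
  have hs2 : 2 ≤ s := by nlinarith
  have hst : s < t := by nlinarith
  have key : t ^ 2 * (1 + s) ^ 3 < s ^ 2 * (1 + t) ^ 3 := by
    have factored : s ^ 2 * (1 + t) ^ 3 - t ^ 2 * (1 + s) ^ 3
        = (t - s) * (s ^ 2 * t ^ 2 - 3 * s * t - s - t) := by ring
    have hx : 0 < s ^ 2 * t ^ 2 - 3 * s * t - s - t := by
      have h4 : 4 < s * t := by nlinarith
      have h5 : s + t ≤ 2 + s * t / 2 := by nlinarith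
      nlinarith
    nlinarith [mul_pos (sub_pos.2 hst) hx]
  have e₁ : -216 * u ^ 2 * (1 + u) ^ 2 / (1 + u + u ^ 2) ^ 3
      = -216 * s ^ 2 / (1 + s) ^ 3 := by
    rw [hs]; ring_nf
  have e₂ : -216 * v ^ 2 * (1 + v) ^ 2 / (1 + v + v ^ 2) ^ 3
      = -216 * t ^ 2 / (1 + t) ^ 3 := by
    rw [ht]; ring_nf
  simp only [e₁, e₂]
  have h₁ : 0 < (1 + s) ^ 3 := by positivity
  have h₂ : 0 < (1 + t) ^ 3 := pow_pos (by linarith) 3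
  rw [div_lt_div_iff₀ h₁ h₂]
  linarith

/-- Every value in `[-32,0)` is attained by the right-hand side of the Kasner relation. -/
theorem exists_kasner_eq {y : ℝ} (hlo : -32 ≤ y) (hneg : y < 0) :
    ∃ u : ℝ, 1 ≤ u ∧ y = -216 * u ^ 2 * (1 + u) ^ 2 / (1 + u + u ^ 2) ^ 3 := by
  obtain ⟨M, hM⟩ : ∃ M, M = 216 / -y := ⟨_, rfl⟩
  have hy : 0 < -y := by linarith
  have hMy : M * -y = 216 := by rw [hM]; exact div_mul_cancel₀ _ hy.ne'
  have hM1 : 1 ≤ M := by rw [hM, le_div_iff₀ hy]; linarith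
  have hcont : ContinuousOn
      (fun u : ℝ => -216 * u ^ 2 * (1 + u) ^ 2 / (1 + u + u ^ 2) ^ 3) (Set.Icc 1 M) := by
    refine ContinuousOn.div (by fun_prop) (by fun_prop) fun u hu => ?_
    have : 1 ≤ u := hu.1
    positivity
  have hend : y ≤ -216 * M ^ 2 * (1 + M) ^ 2 / (1 + M + M ^ 2) ^ 3 := by
    have hM0 : 0 < M := by linarith
    rw [le_div_iff₀ (by positivity)]
    have hyM : y * M = -216 := by linarith
    have h : M * (M ^ 2 * (1 + M) ^ 2) ≤ (1 + M + M ^ 2) ^ 3 := by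
      have h₁ : M ^ 2 * (1 + M) ^ 2 ≤ (1 + M + M ^ 2) ^ 2 := by nlinarith
      calc M * (M ^ 2 * (1 + M) ^ 2) ≤ (1 + M + M ^ 2) * (1 + M + M ^ 2) ^ 2 := by
            gcongr; nlinarith
        _ = (1 + M + M ^ 2) ^ 3 := by ring
    calc y * (1 + M + M ^ 2) ^ 3 ≤ y * (M * (M ^ 2 * (1 + M) ^ 2)) :=
          mul_le_mul_of_nonpos_left h hneg.le
      _ = (y * M) * M ^ 2 * (1 + M) ^ 2 := by ring
      _ = -216 * M ^ 2 * (1 + M) ^ 2 := by rw [hyM]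
  obtain ⟨u, hu, hue⟩ := intermediate_value_Icc hM1 hcont ⟨by norm_num; linarith, hend⟩
  exact ⟨u, hu.1, hue.symm⟩

/-- On the Kasner circle the product is `8 (Σ₁Σ₂Σ₃ - 2)`, and the discriminant of the cubic with
roots `Σ₁, Σ₂, Σ₃` gives `|Σ₁Σ₂Σ₃| ≤ 2`. -/
theorem kasner_product_bounds {a b c : ℝ} (h₁ : a + b + c = 0) (h₂ : a ^ 2 + b ^ 2 + c ^ 2 = 6) :
    -32 ≤ (2 + 2 * a) * (2 + 2 * b) * (2 + 2 * c) ∧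
      (2 + 2 * a) * (2 + 2 * b) * (2 + 2 * c) ≤ 0 := by
  obtain rfl : c = -a - b := by linarith
  have hb : b ^ 2 = 3 - a ^ 2 - a * b := by linarith
  have hq : (2 + 2 * a) * (2 + 2 * b) * (2 + 2 * (-a - b))
      = 8 * (a * b * (-a - b) - 2) := by linear_combination (-8) * hb
  have hdisc : 27 * (4 - (a * b * (-a - b)) ^ 2)
      = ((a - b) * (b - (-a - b)) * ((-a - b) - a)) ^ 2 := by
    have h3 : a ^ 2 + a * b + b ^ 2 = 3 := by linarith
    have : (4 : ℝ) * (a ^ 2 + a * b + b ^ 2) ^ 3 = 108 := by rw [h3]; norm_num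
    linear_combination -this
  have habs : |a * b * (-a - b)| ≤ 2 := by
    apply abs_le_of_sq_le_sq _ (by norm_num)
    nlinarith [sq_nonneg ((a - b) * (b - (-a - b)) * ((-a - b) - a))]
  obtain ⟨hl, hr⟩ := abs_le.1 habs
  rw [hq]
  constructor <;> linarith

theorem eq_two_neg_one_or_of_add_eq_one {b c : ℝ} (h₁ : b + c = 1) (h₂ : b ^ 2 + c ^ 2 = 5) :
    (b = 2 ∧ c = -1) ∨ (b = -1 ∧ c = 2) := by
  obtain rfl : c = 1 - b := by linarith
  have h : (b - 2) * (b + 1) = 0 := by linarith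
  rcases mul_eq_zero.1 h with h | h
  · left; constructor <;> linarith
  · right; constructor <;> linarith

theorem isTaub_of_product_eq_zero {p : Fin 6 → ℝ} (hp : p ∈ KasnerCircle)
    (h : (2 + 2 * p 0) * (2 + 2 * p 1) * (2 + 2 * p 2) = 0) : IsTaub p := by
  obtain ⟨h₁, h₂, -⟩ := hp
  unfold IsTaub
  rcases mul_eq_zero.1 h with h | h
  · rcases mul_eq_zero.1 h with h | h
    · have ha : p 0 = -1 := by linarith
      rw [ha] at h₁ h₂
      have := eq_two_neg_one_or_of_add_eq_one (b := p 1) (c := p 2) (by linarith) (by linarith)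
      tauto
    · have ha : p 1 = -1 := by linarith
      rw [ha] at h₁ h₂
      have := eq_two_neg_one_or_of_add_eq_one (b := p 0) (c := p 2) (by linarith) (by linarith)
      tauto
  · have ha : p 2 = -1 := by linarith
    rw [ha] at h₁ h₂
    have := eq_two_neg_one_or_of_add_eq_one (b := p 0) (c := p 1) (by linarith) (by linarith)
    tauto

/-- Every non-Taub point of the Kasner circle has a unique Kasner parameter
`u ∈ [1,∞)`. -/
theorem exists_unique_kasner_parameter (p : Fin 6 → ℝ) (hp : p ∈ KasnerCircle)
    (hT : ¬ IsTaub p) :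
    ∃! u : ℝ, 1 ≤ u ∧
      (2 + 2 * p 0) * (2 + 2 * p 1) * (2 + 2 * p 2) =
        -216 * u ^ 2 * (1 + u) ^ 2 / (1 + u + u ^ 2) ^ 3 := by
  obtain ⟨hlo, hle⟩ := kasner_product_bounds hp.1 hp.2.1
  have hneg := lt_of_le_of_ne hle fun h => hT (isTaub_of_product_eq_zero hp h)
  obtain ⟨u, hu, hue⟩ := exists_kasner_eq hlo hneg
  refine ⟨u, ⟨hu, hue⟩, fun v hv => ?_⟩
  exact strictMonoOn_kasner.injOn hv.1 hu (hv.2.symm.trans hue)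
end
end

section
/- If p ∈ 𝒦 has Kasner parameter u ∈ [1,∞), i.e. (Σ₁,Σ₂,Σ₃) satisfies Σ₁+Σ₂+Σ₃ = 0, Σ₁²+Σ₂²+Σ₃² = 6 and (2+2Σ₁)(2+2Σ₂)(2+2Σ₃) = −216 u²(1+u)²/(1+u+u²)³, then the triple (2+2Σ₁, 2+2Σ₂, 2+2Σ₃) is, up to a permutation of its entries, equal to ( −6u/(1+u+u²), 6(1+u)/(1+u+u²), 6u(1+u)/(1+u+u²) ). -/
noncomputable section

/-- Two triples in a domain with the same elementary symmetric functions agree up to a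
permutation. -/
theorem exists_perm_of_esymm_eq {R : Type*} [CommRing R] [IsDomain R] {x y z a b c : R}
    (h₁ : x + y + z = a + b + c) (h₂ : x * y + y * z + z * x = a * b + b * c + c * a)
    (h₃ : x * y * z = a * b * c) :
    ∃ σ : Equiv.Perm (Fin 3), ∀ i : Fin 3, ![x, y, z] i = ![a, b, c] (σ i) := by
  have of_eqs (σ : Equiv.Perm (Fin 3)) (hx : x = ![a, b, c] (σ 0))
      (hy : y = ![a, b, c] (σ 1)) (hz : z = ![a, b, c] (σ 2)) :
      ∃ σ : Equiv.Perm (Fin 3), ∀ i : Fin 3, ![x, y, z] i = ![a, b, c] (σ i) :=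
    ⟨σ, Fin.forall_fin_succ.2 ⟨hx, Fin.forall_fin_two.2 ⟨hy, hz⟩⟩⟩
  have pair {v w : R} (hs : y + z = v + w) (hp : y * z = v * w) :
      y = v ∧ z = w ∨ y = w ∧ z = v := by
    have h : (y - v) * (y - w) = 0 := by linear_combination y * hs - hp
    rcases mul_eq_zero.1 h with h | h
    · exact .inl ⟨sub_eq_zero.1 h, by linear_combination hs - h⟩
    · exact .inr ⟨sub_eq_zero.1 h, by linear_combination hs - h⟩
  have hroot : (x - a) * (x - b) * (x - c) = 0 := by
    linear_combination x ^ 2 * h₁ - x * h₂ + h₃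
  rcases mul_eq_zero.1 hroot with h | h
  · rcases mul_eq_zero.1 h with h | h <;> obtain rfl := sub_eq_zero.1 h
    · have hs : y + z = b + c := by linear_combination h₁
      rcases pair hs (by linear_combination h₂ - x * hs) with ⟨hy, hz⟩ | ⟨hy, hz⟩
      · exact of_eqs 1 rfl hy hz
      · exact of_eqs (Equiv.swap 1 2) rfl hy hz
    · have hs : y + z = a + c := by linear_combination h₁
      rcases pair hs (by linear_combination h₂ - x * hs) with ⟨hy, hz⟩ | ⟨hy, hz⟩
      · exact of_eqs (Equiv.swap 0 1) rfl hy hz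
      · exact of_eqs (finRotate 3) rfl hy hz
  · obtain rfl := sub_eq_zero.1 h
    have hs : y + z = a + b := by linear_combination h₁
    rcases pair hs (by linear_combination h₂ - x * hs) with ⟨hy, hz⟩ | ⟨hy, hz⟩
    · exact of_eqs (finRotate 3).symm rfl hy hz
    · exact of_eqs (Equiv.swap 0 2) rfl hy hz

/-- If `p ∈ 𝒦` has Kasner parameter `u`, then `(2+2Σ₁, 2+2Σ₂, 2+2Σ₃)` equals, up to a
permutation of its entries, `(−6u/(1+u+u²), 6(1+u)/(1+u+u²), 6u(1+u)/(1+u+u²))`. -/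
theorem kasner_eigenvalues_up_to_permutation (p : Fin 6 → ℝ) (hp : p ∈ KasnerCircle)
    (u : ℝ) (hu : 1 ≤ u)
    (hK : (2 + 2 * p 0) * (2 + 2 * p 1) * (2 + 2 * p 2) =
      -216 * u ^ 2 * (1 + u) ^ 2 / (1 + u + u ^ 2) ^ 3) :
    ∃ σ : Equiv.Perm (Fin 3), ∀ i : Fin 3,
      ![2 + 2 * p 0, 2 + 2 * p 1, 2 + 2 * p 2] i =
        ![-6 * u / (1 + u + u ^ 2), 6 * (1 + u) / (1 + u + u ^ 2),
          6 * u * (1 + u) / (1 + u + u ^ 2)] (σ i) := by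
  obtain ⟨hsum, hsq, -⟩ := hp
  have hD : 1 + u + u ^ 2 ≠ 0 := by positivity
  apply exists_perm_of_esymm_eq
  · field_simp
    linear_combination 2 * (1 + u + u ^ 2) * hsum
  · have hzero : -6 * u / (1 + u + u ^ 2) * (6 * (1 + u) / (1 + u + u ^ 2)) +
        6 * (1 + u) / (1 + u + u ^ 2) * (6 * u * (1 + u) / (1 + u + u ^ 2)) +
        6 * u * (1 + u) / (1 + u + u ^ 2) * (-6 * u / (1 + u + u ^ 2)) = 0 := by
      field_simp
      ring
    rw [hzero]
    linear_combination (2 * (p 0 + p 1 + p 2) + 8) * hsum - 2 * hsq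
  · rw [hK]
    field_simp
    ring
end
end

section
/- Domination of the unstable eigenvalue by the stable eigenvalues at non-Taub Kasner points: let p ∈ 𝒦 be a point which is not a Taub point, and let i ∈ {1,2,3} be the (unique) index with 2+2Σᵢ < 0. Then for every j ≠ i one has −(2+2Σᵢ) < 2+2Σⱼ; that is, the positive eigenvalue λᵘ = −(2+2Σᵢ) of DX(p) is strictly smaller than the absolute value of each of the two negative eigenvalues −(2+2Σⱼ), so that |λˢ/λᵘ| > 1 for each negative eigenvalue λˢ. -/
noncomputable section

/-- If the zero-sum triple `a, b, c` has square sum `6` and `a < -1`, then `-(2 + 2a) < 2 + 2b`. -/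
lemma neg_two_add_two_mul_lt {a b c : ℝ} (hs : a + b + c = 0)
    (hq : a ^ 2 + b ^ 2 + c ^ 2 = 6) (ha : 2 + 2 * a < 0) : -(2 + 2 * a) < 2 + 2 * b := by
  obtain rfl : c = -a - b := by linarith
  by_contra! h
  have hab : (a - b) ^ 2 ≤ 0 := by nlinarith
  have : a = b := sub_eq_zero.mp (pow_eq_zero_iff two_ne_zero |>.mp (hab.antisymm (sq_nonneg _)))
  subst this
  nlinarith

/-- Domination of the unstable eigenvalue by the stable eigenvalues at non-Taub Kasner
points: if `2+2Σᵢ < 0`, then for every `j ≠ i` one has `−(2+2Σᵢ) < 2+2Σⱼ`. -/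
theorem kasner_eigenvalue_domination (p : Fin 6 → ℝ) (hp : p ∈ KasnerCircle)
    (hT : ¬ IsTaub p) (i : Fin 3)
    (hi : ![2 + 2 * p 0, 2 + 2 * p 1, 2 + 2 * p 2] i < 0) :
    ∀ j : Fin 3, j ≠ i →
      -(![2 + 2 * p 0, 2 + 2 * p 1, 2 + 2 * p 2] i) <
        ![2 + 2 * p 0, 2 + 2 * p 1, 2 + 2 * p 2] j := by
  obtain ⟨hs, hq, -⟩ := hp
  intro j hj
  fin_cases i <;> fin_cases j
  · exact absurd rfl hj
  · exact neg_two_add_two_mul_lt (a := p 0) (b := p 1) (c := p 2) hs hq hi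
  · exact neg_two_add_two_mul_lt (a := p 0) (b := p 2) (c := p 1) (by linarith) (by linarith) hi
  · exact neg_two_add_two_mul_lt (a := p 1) (b := p 0) (c := p 2) (by linarith) (by linarith) hi
  · exact absurd rfl hj
  · exact neg_two_add_two_mul_lt (a := p 1) (b := p 2) (c := p 0) (by linarith) (by linarith) hi
  · exact neg_two_add_two_mul_lt (a := p 2) (b := p 0) (c := p 1) (by linarith) (by linarith) hi
  · exact neg_two_add_two_mul_lt (a := p 2) (b := p 1) (c := p 0) (by linarith) (by linarith) hi
  · exact absurd rfl hj
end
end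

section
/- Let p ∈ 𝒦 be a point which is not a Taub point and let u ∈ [1,∞) be its Kasner parameter. Then the three real numbers 2+2Σ₁, 2+2Σ₂, 2+2Σ₃ (the negatives of the nonzero eigenvalues of the derivative of the Wainwright–Hsu vector field at p) are linearly independent over ℚ if and only if u is neither a rational number nor a quadratic irrational. -/
noncomputable section

/-- A real number is a quadratic irrational if it is irrational and is a root of a
quadratic polynomial with integer coefficients (with nonzero leading coefficient). -/
def IsQuadraticIrrational (u : ℝ) : Prop :=
  Irrational u ∧ ∃ a b c : ℤ, a ≠ 0 ∧ (a : ℝ) * u ^ 2 + (b : ℝ) * u + (c : ℝ) = 0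

/-- Linear independence over `ℚ` of three real numbers. -/
def RatIndep (x y z : ℝ) : Prop :=
  ∀ a b c : ℚ, (a : ℝ) * x + (b : ℝ) * y + (c : ℝ) * z = 0 → a = 0 ∧ b = 0 ∧ c = 0

theorem RatIndep.swap_left {x y z : ℝ} (h : RatIndep x y z) : RatIndep y x z := by
  intro a b c e
  obtain ⟨hb, ha, hc⟩ := h b a c (by linarith)
  exact ⟨ha, hb, hc⟩

theorem RatIndep.swap_right {x y z : ℝ} (h : RatIndep x y z) : RatIndep x z y := by
  intro a b c e
  obtain ⟨ha, hc, hb⟩ := h a c b (by linarith)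
  exact ⟨ha, hb, hc⟩

theorem ratIndep_mul_left_iff {k : ℝ} (hk : k ≠ 0) (x y z : ℝ) :
    RatIndep (k * x) (k * y) (k * z) ↔ RatIndep x y z := by
  have key (a b c : ℚ) : (a : ℝ) * (k * x) + b * (k * y) + c * (k * z) = 0 ↔
      (a : ℝ) * x + b * y + c * z = 0 := by
    rw [show (a : ℝ) * (k * x) + b * (k * y) + c * (k * z) = k * (a * x + b * y + c * z) by ring]
    simp [hk]
  simp only [RatIndep, key]

/-- The Kasner exponents, up to a common factor, are rationally independent exactly when the
powers `1, u, u ^ 2` are. -/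
theorem ratIndep_kasner_iff (u : ℝ) :
    RatIndep (-u) (1 + u) (u * (1 + u)) ↔ RatIndep 1 u (u ^ 2) := by
  constructor
  · intro h a b c e
    obtain ⟨h1, h2, h3⟩ := h (a + c - b) a c (by push_cast; linear_combination e)
    exact ⟨h2, by linarith, h3⟩
  · intro h a b c e
    obtain ⟨h1, h2, h3⟩ := h b (b + c - a) c (by push_cast; linear_combination e)
    exact ⟨by linarith, h1, h3⟩

/-- Clearing denominators in a rational quadratic relation. -/
theorem exists_int_quadratic {u : ℝ} {a b c : ℚ} (hc : c ≠ 0)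
    (e : (a : ℝ) * 1 + b * u + c * u ^ 2 = 0) :
    ∃ A B C : ℤ, A ≠ 0 ∧ (A : ℝ) * u ^ 2 + (B : ℝ) * u + (C : ℝ) = 0 := by
  refine ⟨c.num * a.den * b.den, b.num * a.den * c.den, a.num * b.den * c.den, ?_, ?_⟩
  · simp [hc]
  · have h (q : ℚ) : (q.num : ℝ) = q * q.den := by exact_mod_cast (Rat.mul_den_eq_num q).symm
    push_cast
    rw [h a, h b, h c]
    linear_combination (a.den * b.den * c.den : ℝ) * e

theorem ratIndep_powers_iff (u : ℝ) :
    RatIndep 1 u (u ^ 2) ↔ Irrational u ∧ ¬ IsQuadraticIrrational u := by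
  constructor
  · intro h
    refine ⟨?_, ?_⟩
    · rintro ⟨q, rfl⟩
      have := (h q (-1) 0 (by push_cast; ring)).2.1
      norm_num at this
    · rintro ⟨-, a, b, c, ha, e⟩
      have := (h c b a (by push_cast; linear_combination e)).2.2
      exact ha (by exact_mod_cast this)
  · rintro ⟨hu, hq⟩ a b c e
    have hc : c = 0 := by
      by_contra hc
      exact hq ⟨hu, exists_int_quadratic hc e⟩
    subst hc
    have hb : b = 0 := by
      by_contra hb
      refine hu ⟨-a / b, ?_⟩
      have hb' : (b : ℝ) ≠ 0 := by exact_mod_cast hb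
      push_cast at e ⊢
      field_simp
      linear_combination -e
    subst hb
    have ha : (a : ℝ) = 0 := by simpa using e
    exact ⟨by exact_mod_cast ha, rfl, rfl⟩

/-- Two real pairs with the same sum and the same sum of squares agree up to order. -/
theorem eq_or_swap_of_add_eq_of_sq_add_sq_eq {a b c d : ℝ} (h1 : a + b = c + d)
    (h2 : a ^ 2 + b ^ 2 = c ^ 2 + d ^ 2) : (a = c ∧ b = d) ∨ (a = d ∧ b = c) := by
  have h : (a - c) * (a - d) = 0 := by
    obtain rfl : b = c + d - a := by linarith
    linear_combination h2 / 2
  rcases mul_eq_zero.mp h with h | h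
  · exact Or.inl ⟨by linarith, by linarith⟩
  · exact Or.inr ⟨by linarith, by linarith⟩

/-- Rational independence only depends on the first two power sums and the product. -/
theorem RatIndep.of_symm_eq {x y z a b c : ℝ} (h : RatIndep a b c)
    (h1 : x + y + z = a + b + c) (h2 : x ^ 2 + y ^ 2 + z ^ 2 = a ^ 2 + b ^ 2 + c ^ 2)
    (h3 : x * y * z = a * b * c) : RatIndep x y z := by
  have hx : (x - a) * ((x - b) * (x - c)) = 0 := by
    obtain rfl : z = a + b + c - x - y := by linarith
    linear_combination h3 + x / 2 * h2
  rcases mul_eq_zero.mp hx with hx | hx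
  · obtain rfl : x = a := by linarith
    rcases eq_or_swap_of_add_eq_of_sq_add_sq_eq (a := y) (b := z) (c := b) (d := c)
      (by linarith) (by linarith) with ⟨rfl, rfl⟩ | ⟨rfl, rfl⟩
    · exact h
    · exact h.swap_right
  rcases mul_eq_zero.mp hx with hx | hx
  · obtain rfl : x = b := by linarith
    rcases eq_or_swap_of_add_eq_of_sq_add_sq_eq (a := y) (b := z) (c := a) (d := c)
      (by linarith) (by linarith) with ⟨rfl, rfl⟩ | ⟨rfl, rfl⟩
    · exact h.swap_left
    · exact h.swap_left.swap_right
  · obtain rfl : x = c := by linarith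
    rcases eq_or_swap_of_add_eq_of_sq_add_sq_eq (a := y) (b := z) (c := a) (d := b)
      (by linarith) (by linarith) with ⟨rfl, rfl⟩ | ⟨rfl, rfl⟩
    · exact h.swap_right.swap_left
    · exact h.swap_right.swap_left.swap_right

/-- For a non-Taub point `p ∈ 𝒦` with Kasner parameter `u`, the numbers
`2+2Σ₁, 2+2Σ₂, 2+2Σ₃` are linearly independent over ℚ if and only if `u` is neither
rational nor a quadratic irrational. -/
theorem kasner_sternberg_criterion (p : Fin 6 → ℝ) (hp : p ∈ KasnerCircle)
    (hT : ¬ IsTaub p) (u : ℝ) (hu : 1 ≤ u)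
    (hK : (2 + 2 * p 0) * (2 + 2 * p 1) * (2 + 2 * p 2) =
      -216 * u ^ 2 * (1 + u) ^ 2 / (1 + u + u ^ 2) ^ 3) :
    (∀ a b c : ℚ, (a : ℝ) * (2 + 2 * p 0) + (b : ℝ) * (2 + 2 * p 1)
          + (c : ℝ) * (2 + 2 * p 2) = 0 → a = 0 ∧ b = 0 ∧ c = 0) ↔
      (Irrational u ∧ ¬ IsQuadraticIrrational u) := by
  obtain ⟨hs, hsq, -, -, -⟩ := hp
  have hD : 1 + u + u ^ 2 ≠ 0 := by positivity
  rw [← ratIndep_powers_iff, ← ratIndep_kasner_iff,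
    ← ratIndep_mul_left_iff (div_ne_zero (by norm_num : (6 : ℝ) ≠ 0) hD)]
  have h1 : (2 + 2 * p 0) + (2 + 2 * p 1) + (2 + 2 * p 2) =
      6 / (1 + u + u ^ 2) * -u + 6 / (1 + u + u ^ 2) * (1 + u) +
        6 / (1 + u + u ^ 2) * (u * (1 + u)) := by
    field_simp
    linear_combination 2 * (1 + u + u ^ 2) * hs
  have h2 : (2 + 2 * p 0) ^ 2 + (2 + 2 * p 1) ^ 2 + (2 + 2 * p 2) ^ 2 =
      (6 / (1 + u + u ^ 2) * -u) ^ 2 + (6 / (1 + u + u ^ 2) * (1 + u)) ^ 2 +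
        (6 / (1 + u + u ^ 2) * (u * (1 + u))) ^ 2 := by
    have : (2 + 2 * p 0) ^ 2 + (2 + 2 * p 1) ^ 2 + (2 + 2 * p 2) ^ 2 = 36 := by
      linear_combination 8 * hs + 4 * hsq
    rw [this]
    field_simp
    ring
  have h3 : (2 + 2 * p 0) * (2 + 2 * p 1) * (2 + 2 * p 2) =
      (6 / (1 + u + u ^ 2) * -u) * (6 / (1 + u + u ^ 2) * (1 + u)) *
        (6 / (1 + u + u ^ 2) * (u * (1 + u))) := by
    rw [hK]
    field_simp
    ring
  exact ⟨fun h => RatIndep.of_symm_eq h h1.symm h2.symm h3.symm,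
    fun h => h.of_symm_eq h1 h2 h3⟩
end
end

section
/- Let u > 1 be an irrational real number. Then for every n ≥ 0 the iterate f̄ⁿ(u) is irrational and strictly greater than 1, and u is preperiodic under f̄ (i.e. there exist integers 0 ≤ m < n with f̄ᵐ(u) = f̄ⁿ(u)) if and only if u is a quadratic irrational. -/
noncomputable section

/-- The Kasner map in terms of the Kasner parameter:
`f̄(u) = u − 1` if `u ≥ 2`, `f̄(u) = 1/(u−1)` if `1 < u < 2`, and `f̄(u) = 0` if `u ≤ 1`. -/
def fbar (u : ℝ) : ℝ :=
  if 2 ≤ u then u - 1 else if 1 < u then 1 / (u - 1) else 0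

lemma fbar_irrational_and_one_lt {v : ℝ} (hv : Irrational v) (h1 : 1 < v) :
    Irrational (fbar v) ∧ 1 < fbar v := by
  have hirr : Irrational (v - 1) := by simpa using hv.sub_intCast 1
  unfold fbar
  split_ifs with h2
  · refine ⟨hirr, ?_⟩
    have : v ≠ 2 := by simpa using hv.ne_ofNat 2
    have : 2 < v := lt_of_le_of_ne h2 this.symm
    linarith
  · refine ⟨by simpa using hirr.inv, ?_⟩
    rw [lt_div_iff₀ (by linarith)]
    linarith

lemma fbar_iterate_irrational_and_one_lt {v : ℝ} (hv : Irrational v) (h1 : 1 < v) (n : ℕ) :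
    Irrational (fbar^[n] v) ∧ 1 < fbar^[n] v := by
  induction n with
  | zero => exact ⟨hv, h1⟩
  | succ n ih =>
    rw [Function.iterate_succ_apply']
    exact fbar_irrational_and_one_lt ih.1 ih.2

/-- An irrational number satisfies no nontrivial linear equation over the integers. -/
lemma Irrational.eq_zero_of_intCast_mul_add_eq_zero {v : ℝ} (hv : Irrational v) {b c : ℤ}
    (h : (b : ℝ) * v + c = 0) : b = 0 ∧ c = 0 := by
  have hb : b = 0 := by
    by_contra hb
    have := (hv.intCast_mul hb).add_intCast c
    rw [h] at this
    exact not_irrational_zero this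
  subst hb
  refine ⟨rfl, ?_⟩
  simpa using h

lemma IsQuadraticIrrational.of_fbar {v : ℝ} (hv : Irrational v) (h1 : 1 < v)
    (h : IsQuadraticIrrational (fbar v)) : IsQuadraticIrrational v := by
  obtain ⟨-, a, b, c, ha, h⟩ := h
  refine ⟨hv, ?_⟩
  unfold fbar at h
  split_ifs at h with h2
  · refine ⟨a, b - 2 * a, a - b + c, ha, ?_⟩
    push_cast
    linear_combination h
  · have hv1 : v - 1 ≠ 0 := by linarith
    have h' : (a : ℝ) + b * (v - 1) + c * (v - 1) ^ 2 = 0 := by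
      field_simp at h
      linear_combination h
    refine ⟨c, b - 2 * c, a - b + c, ?_, ?_⟩
    · rintro rfl
      have hlin : (b : ℝ) * v + ((a - b : ℤ) : ℝ) = 0 := by
        push_cast at h' ⊢
        linear_combination h'
      obtain ⟨rfl, h0⟩ := hv.eq_zero_of_intCast_mul_add_eq_zero hlin
      exact ha (by simpa using h0)
    · push_cast
      linear_combination h'

lemma IsQuadraticIrrational.of_fbar_iterate {v : ℝ} (hv : Irrational v) (h1 : 1 < v) (n : ℕ)
    (h : IsQuadraticIrrational (fbar^[n] v)) : IsQuadraticIrrational v := by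
  induction n with
  | zero => exact h
  | succ n ih =>
    rw [Function.iterate_succ_apply'] at h
    have hn := fbar_iterate_irrational_and_one_lt hv h1 n
    exact ih (h.of_fbar hn.1 hn.2)

/-- The original point is a Möbius transform of any of its iterates, with integer coefficients. -/
lemma exists_mobius_fbar_iterate {v : ℝ} (hv : Irrational v) (h1 : 1 < v) (n : ℕ) :
    ∃ p q r s : ℤ, 1 ≤ p ∧ 0 ≤ q ∧ (0 < n → 1 ≤ q) ∧
      v * (r * fbar^[n] v + s) = p * fbar^[n] v + q := by
  induction n with
  | zero => exact ⟨1, 0, 0, 1, by simp⟩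
  | succ n ih =>
    obtain ⟨p, q, r, s, hp, hq, -, h⟩ := ih
    rw [Function.iterate_succ_apply']
    have hw := (fbar_iterate_irrational_and_one_lt hv h1 n).2
    generalize fbar^[n] v = w at h hw
    unfold fbar
    split_ifs with h2
    · refine ⟨p, p + q, r, r + s, hp, by lia, by lia, ?_⟩
      push_cast
      linear_combination h
    · refine ⟨p + q, p, r + s, r, by lia, by lia, by lia, ?_⟩
      have hw1 : w - 1 ≠ 0 := by linarith
      push_cast
      field_simp
      linear_combination h

lemma isQuadraticIrrational_of_fbar_iterate_eq {v : ℝ} (hv : Irrational v) (h1 : 1 < v) {n : ℕ}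
    (hn : 0 < n) (h : fbar^[n] v = v) : IsQuadraticIrrational v := by
  obtain ⟨p, q, r, s, -, -, hq, e⟩ := exists_mobius_fbar_iterate hv h1 n
  rw [h] at e
  refine ⟨hv, r, s - p, -q, ?_, ?_⟩
  · rintro rfl
    have hlin : ((s - p : ℤ) : ℝ) * v + ((-q : ℤ) : ℝ) = 0 := by
      push_cast at e ⊢
      linear_combination e
    have := (hv.eq_zero_of_intCast_mul_add_eq_zero hlin).2
    have := hq hn
    lia
  · push_cast
    linear_combination e

/-- `v` and `w` are the two roots of an integral quadratic polynomial with leading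
coefficient `a` and discriminant `D`. -/
def IsRootPair (D : ℝ) (a : ℤ) (v w : ℝ) : Prop :=
  a ≠ 0 ∧ (a : ℝ) ^ 2 * (v - w) ^ 2 = D ∧
    ∃ b c : ℤ, (b : ℝ) = -(a * (v + w)) ∧ (c : ℝ) = a * v * w

namespace IsRootPair

variable {D : ℝ} {a : ℤ} {v w : ℝ}

lemma irrational_right (h : IsRootPair D a v w) (hv : Irrational v) : Irrational w := by
  obtain ⟨ha, -, b, -, hb, -⟩ := h
  have ha' : (a : ℝ) ≠ 0 := by exact_mod_cast ha
  have hw : (a : ℝ) * w = -(a * v) - b := by rw [hb]; ring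
  have := ((hv.intCast_mul ha).neg).sub_intCast b
  rw [← hw] at this
  exact this.of_intCast_mul a

lemma sub_one (h : IsRootPair D a v w) : IsRootPair D a (v - 1) (w - 1) := by
  obtain ⟨ha, hD, b, c, hb, hc⟩ := h
  refine ⟨ha, by rw [← hD]; ring, 2 * a + b, a + b + c, ?_, ?_⟩
  · push_cast
    rw [hb]
    ring
  · push_cast
    rw [hb, hc]
    ring

lemma inv_sub_one (h : IsRootPair D a v w) (hv : v ≠ 1) (hw : w ≠ 1) :
    ∃ a' : ℤ, (a' : ℝ) = a * ((v - 1) * (w - 1)) ∧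
      IsRootPair D a' (1 / (v - 1)) (1 / (w - 1)) := by
  have hv' : v - 1 ≠ 0 := sub_ne_zero.2 hv
  have hw' : w - 1 ≠ 0 := sub_ne_zero.2 hw
  obtain ⟨ha, hD, b, c, hb, hc⟩ := h
  have ha' : (a : ℝ) ≠ 0 := by exact_mod_cast ha
  have key : ((a + b + c : ℤ) : ℝ) = a * ((v - 1) * (w - 1)) := by
    push_cast
    rw [hb, hc]
    ring
  refine ⟨a + b + c, key, ?_, ?_, 2 * a + b, a, ?_, ?_⟩
  · have : ((a + b + c : ℤ) : ℝ) ≠ 0 := by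
      rw [key]
      positivity
    exact_mod_cast this
  · rw [key, ← hD]
    field_simp
    ring
  · rw [key]
    push_cast
    rw [hb]
    field_simp
    ring
  · rw [key]
    field_simp

lemma fbar_left (h : IsRootPair D a v w) (hv : Irrational v) (h1 : 1 < v) :
    ∃ (a' : ℤ) (w' : ℝ), IsRootPair D a' (fbar v) w' ∧ (w < 1 → w' < 0) := by
  have hw : w ≠ 1 := (h.irrational_right hv).ne_one
  unfold fbar
  split_ifs with h2
  · exact ⟨a, w - 1, h.sub_one, fun hw => by linarith⟩
  · obtain ⟨a', -, h'⟩ := h.inv_sub_one h1.ne' hw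
    exact ⟨a', _, h', fun hw => one_div_neg.2 (by linarith)⟩

lemma exists_fbar_iterate_of_lt_one (h : IsRootPair D a v w) (hv : Irrational v) (h1 : 1 < v)
    (hw : w < 1) : ∃ (n : ℕ) (a' : ℤ) (w' : ℝ), IsRootPair D a' (fbar^[n] v) w' ∧ w' < 0 := by
  obtain ⟨a', w', h', hw'⟩ := h.fbar_left hv h1
  exact ⟨1, a', w', h', hw' hw⟩

/-- Along the orbit of a quadratic irrational, the conjugate eventually becomes negative. -/
lemma exists_fbar_iterate_neg (h : IsRootPair D a v w) (hv : Irrational v) (h1 : 1 < v) :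
    ∃ (n : ℕ) (a' : ℤ) (w' : ℝ), IsRootPair D a' (fbar^[n] v) w' ∧ w' < 0 := by
  induction hA : a.natAbs using Nat.strong_induction_on generalizing a v w with
  | _ A ihA =>
    obtain ⟨k, hk⟩ := exists_nat_gt v
    induction k generalizing v w with
    | zero =>
      push_cast at hk
      linarith
    | succ k ihk =>
      obtain ⟨hfi, hf1⟩ := fbar_irrational_and_one_lt hv h1
      suffices H : w < 1 ∨ ∃ (n : ℕ) (a' : ℤ) (w' : ℝ),
          IsRootPair D a' (fbar^[n] (fbar v)) w' ∧ w' < 0 by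
        rcases H with hw | ⟨n, a', w', h', hw'⟩
        · exact h.exists_fbar_iterate_of_lt_one hv h1 hw
        · exact ⟨n + 1, a', w', h', hw'⟩
      by_cases hw : w < 1
      · exact Or.inl hw
      right
      have hw1 : 1 < w :=
        lt_of_le_of_ne (not_lt.1 hw) (h.irrational_right hv).ne_one.symm
      by_cases h2 : 2 ≤ v
      · have hf : fbar v = v - 1 := if_pos h2
        rw [hf] at hfi hf1 ⊢
        push_cast at hk
        exact ihk h.sub_one hfi hf1 (by linarith)
      · have hf : fbar v = 1 / (v - 1) := by simp [fbar, h2, h1]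
        rw [hf] at hfi hf1 ⊢
        obtain ⟨a', ha', h'⟩ := h.inv_sub_one h1.ne' hw1.ne'
        by_cases hw2 : 2 < w
        · refine h'.exists_fbar_iterate_of_lt_one hfi hf1 ?_
          rw [div_lt_one (by linarith)]
          linarith
        · refine ihA a'.natAbs ?_ h' hfi hf1 rfl
          have hlt : |(a' : ℝ)| < |(a : ℝ)| := by
            have ha : 0 < |(a : ℝ)| := abs_pos.2 (by exact_mod_cast h.1)
            have hpos : 0 < (v - 1) * (w - 1) := mul_pos (by linarith) (by linarith)
            rw [ha', abs_mul, abs_of_pos hpos]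
            refine mul_lt_of_lt_one_right ha ?_
            nlinarith
          rw [← hA]
          exact Int.natAbs_lt_iff_sq_lt.2 (sq_lt_sq.2 (by exact_mod_cast hlt))

lemma fbar_iterate_neg (h : IsRootPair D a v w) (hv : Irrational v) (h1 : 1 < v) (hw : w < 0)
    (n : ℕ) : ∃ (a' : ℤ) (w' : ℝ), IsRootPair D a' (fbar^[n] v) w' ∧ w' < 0 := by
  induction n with
  | zero => exact ⟨a, w, h, hw⟩
  | succ n ih =>
    obtain ⟨a', w', h', hw'⟩ := ih
    have hn := fbar_iterate_irrational_and_one_lt hv h1 n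
    obtain ⟨a'', w'', h'', hw''⟩ := h'.fbar_left hn.1 hn.2
    rw [Function.iterate_succ_apply']
    exact ⟨a'', w'', h'', hw'' (by linarith)⟩

end IsRootPair

/-- There are finitely many reduced quadratic irrationals of a given discriminant. -/
lemma finite_setOf_isRootPair (D : ℝ) :
    {v : ℝ | 1 < v ∧ ∃ (a : ℤ) (w : ℝ), IsRootPair D a v w ∧ w < 0}.Finite := by
  obtain ⟨N, hN⟩ := exists_int_gt D
  refine (((Set.finite_Icc (-N) N).prod (Set.finite_Icc (-N) N)).image
    fun x : ℤ × ℤ => (-(x.2 : ℝ) / x.1 + √D / |(x.1 : ℝ)|) / 2).subset ?_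
  rintro v ⟨h1, a, w, ⟨ha, hD, b, c, hb, hc⟩, hw⟩
  have ha' : (a : ℝ) ≠ 0 := by exact_mod_cast ha
  have hvw : v * w < 0 := mul_neg_of_pos_of_neg (by linarith) hw
  have ha2 : 0 < (a : ℝ) ^ 2 := by positivity
  have hac : a * c < 0 := by
    have : (a : ℝ) * c < 0 := by
      rw [hc]
      nlinarith
    exact_mod_cast this
  have hbD : b ^ 2 - 4 * (a * c) < N := by
    have : (b : ℝ) ^ 2 - 4 * (a * c) < N := by
      refine lt_of_eq_of_lt ?_ hN
      rw [← hD, hb, hc]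
      ring
    exact_mod_cast this
  have hc0 : c ≠ 0 := by
    rintro rfl
    simp at hac
  have haN : |a| ≤ N := by
    have h2 : |a| * |c| = -(a * c) := by rw [← abs_mul, abs_of_neg hac]
    have := Int.one_le_abs hc0
    nlinarith [sq_nonneg b, abs_nonneg a]
  have hbN : |b| ≤ N := by
    rcases eq_or_ne b 0 with rfl | hb0
    · simpa using (abs_nonneg a).trans haN
    · have := Int.one_le_abs hb0
      nlinarith [sq_abs b]
  refine ⟨(a, b), ⟨abs_le.1 haN, abs_le.1 hbN⟩, ?_⟩
  have hsqrt : √D = |(a : ℝ)| * (v - w) := by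
    rw [← hD, ← mul_pow, Real.sqrt_sq_eq_abs, abs_mul, abs_of_pos (a := v - w) (by linarith)]
  have haa : |(a : ℝ)| ≠ 0 := abs_ne_zero.2 ha'
  simp only [hsqrt, hb]
  field_simp
  ring

lemma IsQuadraticIrrational.exists_isRootPair {v : ℝ} (h : IsQuadraticIrrational v) :
    ∃ (D : ℝ) (a : ℤ) (w : ℝ), IsRootPair D a v w := by
  obtain ⟨-, a, b, c, ha, h⟩ := h
  have ha' : (a : ℝ) ≠ 0 := by exact_mod_cast ha
  refine ⟨_, a, -b / a - v, ha, rfl, b, c, ?_, ?_⟩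
  · field_simp
    ring
  · field_simp
    linear_combination h

lemma IsQuadraticIrrational.exists_fbar_iterate_eq {v : ℝ} (h : IsQuadraticIrrational v)
    (h1 : 1 < v) : ∃ m n : ℕ, m < n ∧ fbar^[m] v = fbar^[n] v := by
  obtain ⟨D, a, w, hR⟩ := h.exists_isRootPair
  obtain ⟨k, a', w', hR', hw'⟩ := hR.exists_fbar_iterate_neg h.1 h1
  have hk := fbar_iterate_irrational_and_one_lt h.1 h1 k
  have hmem (n : ℕ) : fbar^[n] (fbar^[k] v) ∈
      {x : ℝ | 1 < x ∧ ∃ (a : ℤ) (w : ℝ), IsRootPair D a x w ∧ w < 0} :=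
    ⟨(fbar_iterate_irrational_and_one_lt hk.1 hk.2 n).2,
      hR'.fbar_iterate_neg hk.1 hk.2 hw' n⟩
  obtain ⟨m, n, hmn, e⟩ :=
    (finite_setOf_isRootPair D).exists_lt_map_eq_of_forall_mem hmem
  refine ⟨m + k, n + k, by lia, ?_⟩
  simpa only [Function.iterate_add_apply] using e

/-- For an irrational `u > 1`, every iterate `f̄ⁿ(u)` is irrational and `> 1`, and `u` is
preperiodic under `f̄` if and only if `u` is a quadratic irrational. -/
theorem fbar_preperiodic_iff_quadratic (u : ℝ) (h1 : 1 < u) (hirr : Irrational u) :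
    (∀ n : ℕ, Irrational (fbar^[n] u) ∧ 1 < fbar^[n] u) ∧
    ((∃ m n : ℕ, m < n ∧ fbar^[m] u = fbar^[n] u) ↔ IsQuadraticIrrational u) := by
  refine ⟨fbar_iterate_irrational_and_one_lt hirr h1, ?_, fun h => h.exists_fbar_iterate_eq h1⟩
  rintro ⟨m, n, hmn, h⟩
  have hm := fbar_iterate_irrational_and_one_lt hirr h1 m
  refine IsQuadraticIrrational.of_fbar_iterate hirr h1 m
    (isQuadraticIrrational_of_fbar_iterate_eq hm.1 hm.2 (Nat.sub_pos_of_lt hmn) ?_)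
  rw [← Function.iterate_add_apply, Nat.sub_add_cancel hmn.le, h]
end
end

section
/- Every rational orbit of the Kasner parameter map terminates at 1: for every rational number u > 1 there exists an integer n ≥ 1 such that f̄ᵏ(u) > 1 for all 0 ≤ k < n and f̄ⁿ(u) = 1. -/
noncomputable section

/-- If `fbar u` is `1`, or the orbit of `fbar u` stays above `1` until it hits `1`, then the orbit
of `u > 1` stays above `1` until it hits `1`. -/
theorem exists_iterate_fbar_eq_one_of_fbar {u : ℝ} (hu : 1 < u)
    (h : fbar u = 1 ∨
      ∃ n : ℕ, 1 ≤ n ∧ (∀ k : ℕ, k < n → 1 < fbar^[k] (fbar u)) ∧ fbar^[n] (fbar u) = 1) :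
    ∃ n : ℕ, 1 ≤ n ∧ (∀ k : ℕ, k < n → 1 < fbar^[k] u) ∧ fbar^[n] u = 1 := by
  rcases h with h | ⟨n, -, hlt, heq⟩
  · refine ⟨1, le_rfl, fun k hk => ?_, by simpa using h⟩
    obtain rfl : k = 0 := by omega
    simpa using hu
  · refine ⟨n + 1, by omega, fun k hk => ?_, by simpa using heq⟩
    cases k with
    | zero => simpa using hu
    | succ k => simpa using hlt k (by omega)

/-- The orbit of a quotient `p / q > 1` of natural numbers stays above `1` until it hits `1`. -/
theorem exists_iterate_fbar_natCast_div_eq_one (p q : ℕ) (hq : 0 < q) (hqp : q < p) :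
    ∃ n : ℕ, 1 ≤ n ∧ (∀ k : ℕ, k < n → 1 < fbar^[k] ((p : ℝ) / q)) ∧
      fbar^[n] ((p : ℝ) / q) = 1 := by
  induction p using Nat.strong_induction_on generalizing q with
  | _ p ih =>
    have hq' : (0 : ℝ) < q := by exact_mod_cast hq
    have hqp' : (q : ℝ) < p := by exact_mod_cast hqp
    have hu : 1 < (p : ℝ) / q := (one_lt_div hq').2 hqp'
    apply exists_iterate_fbar_eq_one_of_fbar hu
    by_cases h2 : 2 * q ≤ p
    · have h2' : 2 ≤ (p : ℝ) / q := (le_div_iff₀ hq').2 (by exact_mod_cast h2)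
      have hf : fbar ((p : ℝ) / q) = ((p - q : ℕ) : ℝ) / q := by
        rw [fbar, if_pos h2', Nat.cast_sub hqp.le, sub_div, div_self hq'.ne']
      rw [hf]
      rcases h2.eq_or_lt with h | h
      · left
        rw [show p - q = q by omega, div_self hq'.ne']
      · exact Or.inr (ih (p - q) (by omega) q hq (by omega))
    · have h2' : ¬ 2 ≤ (p : ℝ) / q := by
        rw [le_div_iff₀ hq']
        exact_mod_cast h2
      have hf : fbar ((p : ℝ) / q) = (q : ℝ) / ((p - q : ℕ) : ℝ) := by
        rw [fbar, if_neg h2', if_pos hu, Nat.cast_sub hqp.le, div_sub_one hq'.ne', one_div_div]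
      rw [hf]
      exact Or.inr (ih q hqp (p - q) (by omega) (by omega))

/-- Every rational orbit of the Kasner parameter map terminates at `1`: for every
rational `u > 1` there is `n ≥ 1` with `f̄ᵏ(u) > 1` for all `k < n` and `f̄ⁿ(u) = 1`. -/
theorem fbar_rational_orbit_terminates (u : ℚ) (hu : 1 < u) :
    ∃ n : ℕ, 1 ≤ n ∧ (∀ k : ℕ, k < n → 1 < fbar^[k] (u : ℝ)) ∧ fbar^[n] (u : ℝ) = 1 := by
  have hnum : (u.num.toNat : ℤ) = u.num := Int.toNat_of_nonneg (Rat.num_pos.2 (by linarith)).le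
  have hcast : (u : ℝ) = (u.num.toNat : ℝ) / (u.den : ℝ) := by
    rw [Rat.cast_def, ← Int.cast_natCast u.num.toNat, hnum]
  have hlt : u.den < u.num.toNat := by
    have h : (u.den : ℝ) < (u.num.toNat : ℝ) := by
      rw [← one_lt_div (by exact_mod_cast u.den_pos), ← hcast]
      exact_mod_cast hu
    exact_mod_cast h
  rw [hcast]
  exact exists_iterate_fbar_natCast_div_eq_one _ _ u.den_pos hlt
end
end

section
/- First return of f̄ to the interval (1,2): let u ∈ (1,2) be irrational and set k = ⌊1/(u−1)⌋. Then k ≥ 1, the iterates satisfy f̄ʲ(u) > 2 for every 1 ≤ j < k, and f̄ᵏ(u) = frac(1/(u−1)) + 1 ∈ (1,2), where frac denotes the fractional part. In other words, the first return map of f̄ to (1,2) is (up to the translation u ↦ u+1) the Gauss map u ↦ frac(1/u). -/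
noncomputable section

/-- As long as the iterates stay at or above `2`, iterating `f̄` subtracts `1` each time. -/
theorem fbar_iterate_eq_sub {x : ℝ} {j : ℕ} (h : (j : ℝ) + 1 ≤ x) : fbar^[j] x = x - j := by
  induction j with
  | zero => simp
  | succ j ih =>
    push_cast at h ⊢
    rw [Function.iterate_succ_apply', ih (by linarith), fbar, if_pos (by linarith)]
    ring

/-- First return of `f̄` to the interval `(1,2)`: for irrational `u ∈ (1,2)` and
`k = ⌊1/(u−1)⌋`, one has `k ≥ 1`, the iterates `f̄ʲ(u)` for `1 ≤ j < k` all exceed `2`,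
and `f̄ᵏ(u) = frac(1/(u−1)) + 1 ∈ (1,2)`: the first return map of `f̄` to `(1,2)` is, up
to the translation `u ↦ u+1`, the Gauss map. -/
theorem fbar_first_return_gauss (u : ℝ) (h1 : 1 < u) (h2 : u < 2) (hirr : Irrational u) :
    1 ≤ ⌊1 / (u - 1)⌋₊ ∧
    (∀ j : ℕ, 1 ≤ j → j < ⌊1 / (u - 1)⌋₊ → 2 < fbar^[j] u) ∧
    fbar^[⌊1 / (u - 1)⌋₊] u = Int.fract (1 / (u - 1)) + 1 ∧
    1 < fbar^[⌊1 / (u - 1)⌋₊] u ∧ fbar^[⌊1 / (u - 1)⌋₊] u < 2 := by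
  have hu : 0 < u - 1 := by linarith
  have hx : Irrational (1 / (u - 1)) := by
    rw [one_div, irrational_inv_iff]
    simpa using hirr.sub_natCast 1
  have hf : fbar u = 1 / (u - 1) := by
    rw [fbar, if_neg (by linarith), if_pos h1]
  have hx1 : 1 ≤ 1 / (u - 1) := by
    rw [le_div_iff₀ hu]
    linarith
  generalize 1 / (u - 1) = x at hx hf hx1 ⊢
  have hk : 1 ≤ ⌊x⌋₊ := Nat.le_floor (by simpa using hx1)
  have hkx : (⌊x⌋₊ : ℝ) < x :=
    lt_of_le_of_ne (Nat.floor_le (by linarith)) (hx.ne_nat _).symm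
  have hxk : x < ⌊x⌋₊ + 1 := Nat.lt_floor_add_one x
  have hit : ∀ j : ℕ, 1 ≤ j → j ≤ ⌊x⌋₊ → fbar^[j] u = x - j + 1 := by
    intro j hj hjk
    obtain ⟨i, rfl⟩ := Nat.exists_eq_add_of_le' hj
    have hjk' : ((i + 1 : ℕ) : ℝ) ≤ ⌊x⌋₊ := by exact_mod_cast hjk
    push_cast at hjk' ⊢
    rw [Function.iterate_succ_apply, hf, fbar_iterate_eq_sub (by linarith)]
    ring
  have hfract : Int.fract x = x - ⌊x⌋₊ := by
    rw [Int.fract, ← natCast_floor_eq_intCast_floor (by linarith : (0 : ℝ) ≤ x)]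
  refine ⟨hk, fun j hj hjk => ?_, ?_, ?_, ?_⟩
  · have hjk' : (j : ℝ) + 1 ≤ ⌊x⌋₊ := by exact_mod_cast hjk
    rw [hit j hj hjk.le]
    linarith
  · rw [hit _ hk le_rfl, hfract]
  · rw [hit _ hk le_rfl]
    linarith
  · rw [hit _ hk le_rfl]
    linarith
end
end

section
/- Regularity of the Dulac map: let λ₁, λ₂, λᵘ : ℝ → ℝ be C¹ functions such that for every y ∈ ℝ one has λ₁(y) < λ₂(y) < 0 < λᵘ(y), −λ₁(y)/λᵘ(y) > 1 and −λ₂(y)/λᵘ(y) > 1, and let γ > 0. Define Δ on the half-space H = ℝ × ℝ × [0,∞) (coordinates (x₂,y,z)) by Δ(x₂,y,z) = ( γ·(z/γ)^{−λ₁(y)/λᵘ(y)}, x₂·(z/γ)^{−λ₂(y)/λᵘ(y)}, y ) for z > 0 and Δ(x₂,y,0) = (0,0,y). Then Δ is continuously differentiable on H (with derivatives taken within H), and at every point of the boundary {z = 0} the derivative of Δ sends the basis vectors e_{x₂} and e_z to 0 and sends e_y to e_y (the third standard basis vector of the target). -/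
noncomputable section

/-- The closed half-space `H = ℝ × ℝ × [0,∞)`, with coordinates `(x₂, y, z)`. -/
def DulacHalfSpace : Set (ℝ × ℝ × ℝ) := {p | 0 ≤ p.2.2}

/-- The Dulac map `Δ(x₂,y,z) = (γ(z/γ)^{−λ₁(y)/λᵘ(y)}, x₂(z/γ)^{−λ₂(y)/λᵘ(y)}, y)` for
`z > 0`, and `Δ(x₂,y,0) = (0,0,y)`. -/
def DulacMap (l1 l2 lu : ℝ → ℝ) (γ : ℝ) (p : ℝ × ℝ × ℝ) : ℝ × ℝ × ℝ :=
  if 0 < p.2.2 then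
    (γ * (p.2.2 / γ) ^ (-(l1 p.2.1) / lu p.2.1),
     p.1 * (p.2.2 / γ) ^ (-(l2 p.2.1) / lu p.2.1),
     p.2.1)
  else (0, 0, p.2.1)

open Filter Topology Asymptotics

/-- The power function of two variables, extended by zero to negative bases. -/
def posRpow (q : ℝ × ℝ) : ℝ := (max q.1 0) ^ q.2

/-- The derivative of `posRpow` at points whose exponent exceeds `1`. -/
def posRpowDeriv (q : ℝ × ℝ) : ℝ × ℝ →L[ℝ] ℝ :=
  (q.2 * (max q.1 0) ^ (q.2 - 1)) • ContinuousLinearMap.fst ℝ ℝ ℝ +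
    ((max q.1 0) ^ (q.2 - 1) * (max q.1 0 * Real.log (max q.1 0))) •
      ContinuousLinearMap.snd ℝ ℝ ℝ

lemma continuousAt_max_rpow_sub_one {q : ℝ × ℝ} (hq : 1 < q.2) :
    ContinuousAt (fun p : ℝ × ℝ => (max p.1 0) ^ (p.2 - 1)) q :=
  ContinuousAt.rpow (by fun_prop) (by fun_prop) (Or.inr (by linarith))

lemma continuousAt_posRpowDeriv {q : ℝ × ℝ} (hq : 1 < q.2) :
    ContinuousAt posRpowDeriv q := by
  have h := continuousAt_max_rpow_sub_one hq
  have hlog : ContinuousAt (fun p : ℝ × ℝ => max p.1 0 * Real.log (max p.1 0)) q :=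
    (Real.continuous_mul_log.comp (continuous_fst.max continuous_const)).continuousAt
  exact ((continuousAt_snd.mul h).smul continuousAt_const).add
    ((h.mul hlog).smul continuousAt_const)

lemma posRpow_eq_mul {q : ℝ × ℝ} (hq : 1 < q.2) :
    posRpow q = (max q.1 0) ^ (q.2 - 1) * max q.1 0 := by
  rw [posRpow, ← Real.rpow_add_one' (le_max_right _ _) (by linarith), sub_add_cancel]

lemma hasFDerivAt_posRpow_zero {w : ℝ} (hw : 1 < w) :
    HasFDerivAt posRpow (0 : ℝ × ℝ →L[ℝ] ℝ) (0, w) := by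
  have hsmall : (fun p : ℝ × ℝ => (max p.1 0) ^ (p.2 - 1)) =o[𝓝 (0, w)]
      (fun _ => (1 : ℝ)) := by
    rw [isLittleO_one_iff]
    have h := continuousAt_max_rpow_sub_one (q := (0, w)) hw
    simpa [ContinuousAt, Real.zero_rpow (show w - 1 ≠ 0 by linarith)] using h
  have hbig : (fun p : ℝ × ℝ => max p.1 0) =O[𝓝 (0, w)] (fun p => p - (0, w)) := by
    refine IsBigO.of_bound 1 (Eventually.of_forall fun p => ?_)
    rw [one_mul, Real.norm_of_nonneg (le_max_right _ _)]
    calc max p.1 0 ≤ ‖(p - (0, w)).1‖ := by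
          simpa using le_abs_self p.1
      _ ≤ ‖p - (0, w)‖ := norm_fst_le _
  have hmul := hsmall.mul_isBigO hbig.norm_right
  refine .of_isLittleO ?_
  refine IsLittleO.of_norm_right (hmul.congr' ?_ (by simp))
  have hev : ∀ᶠ p : ℝ × ℝ in 𝓝 (0, w), 1 < p.2 :=
    continuousAt_snd.eventually (lt_mem_nhds hw)
  filter_upwards [hev] with p hp
  have h0 : posRpow (0, w) = 0 := by
    simp [posRpow, Real.zero_rpow (show w ≠ 0 by linarith)]
  simp [h0, posRpow_eq_mul hp]

lemma hasFDerivAt_posRpow {q : ℝ × ℝ} (hq : 1 < q.2) :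
    HasFDerivAt posRpow (posRpowDeriv q) q := by
  obtain ⟨u, w⟩ := q
  simp only at hq
  have hw : w - 1 ≠ 0 := by linarith
  rcases lt_trichotomy u 0 with hu | rfl | hu
  · have hd : posRpowDeriv (u, w) = 0 := by
      simp [posRpowDeriv, max_eq_right hu.le, Real.zero_rpow hw]
    rw [hd]
    refine (hasFDerivAt_const (0 : ℝ) (u, w)).congr_of_eventuallyEq ?_
    have h1 : ∀ᶠ p : ℝ × ℝ in 𝓝 (u, w), p.1 < 0 :=
      continuousAt_fst.eventually (gt_mem_nhds hu)
    have h2 : ∀ᶠ p : ℝ × ℝ in 𝓝 (u, w), 1 < p.2 :=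
      continuousAt_snd.eventually (lt_mem_nhds hq)
    filter_upwards [h1, h2] with p hp1 hp2
    simp [posRpow_eq_mul hp2, max_eq_right hp1.le]
  · have hd : posRpowDeriv (0, w) = 0 := by
      simp [posRpowDeriv, Real.zero_rpow hw]
    rw [hd]
    exact hasFDerivAt_posRpow_zero hq
  · have h1 : ∀ᶠ p : ℝ × ℝ in 𝓝 (u, w), 0 < p.1 :=
      continuousAt_fst.eventually (lt_mem_nhds hu)
    have h := (Real.hasStrictFDerivAt_rpow_of_pos (u, w) hu).hasFDerivAt
    have hd : posRpowDeriv (u, w) = (w * u ^ (w - 1)) • ContinuousLinearMap.fst ℝ ℝ ℝ +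
        (u ^ w * Real.log u) • ContinuousLinearMap.snd ℝ ℝ ℝ := by
      simp only [posRpowDeriv, max_eq_left hu.le]
      rw [← mul_assoc, ← Real.rpow_add_one hu.ne', sub_add_cancel]
    rw [hd]
    refine h.congr_of_eventuallyEq ?_
    filter_upwards [h1] with p hp
    simp [posRpow, max_eq_left hp.le]

lemma contDiffAt_posRpow {q : ℝ × ℝ} (hq : 1 < q.2) : ContDiffAt ℝ 1 posRpow q := by
  rw [contDiffAt_one_iff]
  exact ⟨posRpowDeriv, {p | 1 < p.2}, continuousAt_snd.eventually (lt_mem_nhds hq),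
    fun p hp => (continuousAt_posRpowDeriv hp).continuousWithinAt,
    fun p hp => hasFDerivAt_posRpow hp⟩

lemma contDiff_posRpow_comp {a : ℝ → ℝ} (ha : ContDiff ℝ 1 a) (h1 : ∀ y, 1 < a y) (γ : ℝ) :
    ContDiff ℝ 1 (fun p : ℝ × ℝ × ℝ => posRpow (p.2.2 / γ, a p.2.1)) := by
  rw [contDiff_iff_contDiffAt]
  intro p
  have hinner : ContDiff ℝ 1 (fun p : ℝ × ℝ × ℝ => (p.2.2 / γ, a p.2.1)) := by
    fun_prop
  exact (contDiffAt_posRpow (q := (p.2.2 / γ, a p.2.1)) (h1 _)).comp p hinner.contDiffAt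

lemma hasFDerivAt_posRpow_comp {a : ℝ → ℝ} (ha : ContDiff ℝ 1 a) (h1 : ∀ y, 1 < a y)
    (γ x y : ℝ) :
    HasFDerivAt (fun p : ℝ × ℝ × ℝ => posRpow (p.2.2 / γ, a p.2.1))
      (0 : ℝ × ℝ × ℝ →L[ℝ] ℝ) (x, y, 0) := by
  have hinner : ContDiff ℝ 1 (fun p : ℝ × ℝ × ℝ => (p.2.2 / γ, a p.2.1)) := by
    fun_prop
  have hd := (hinner.differentiable one_ne_zero (x, y, 0)).hasFDerivAt
  have h0 : HasFDerivAt posRpow (0 : ℝ × ℝ →L[ℝ] ℝ) ((0 : ℝ) / γ, a y) := by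
    rw [zero_div]
    exact hasFDerivAt_posRpow_zero (h1 y)
  have h := HasFDerivAt.comp (g := posRpow) (x, y, (0 : ℝ)) h0 hd
  rw [ContinuousLinearMap.zero_comp] at h
  exact h

lemma dulacMap_eq_posRpow {l1 l2 lu : ℝ → ℝ} (hdom1 : ∀ y : ℝ, 1 < -(l1 y) / lu y)
    (hdom2 : ∀ y : ℝ, 1 < -(l2 y) / lu y) {γ : ℝ} (hγ : 0 < γ) {p : ℝ × ℝ × ℝ}
    (hp : p ∈ DulacHalfSpace) :
    DulacMap l1 l2 lu γ p =
      (γ * posRpow (p.2.2 / γ, -(l1 p.2.1) / lu p.2.1),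
        p.1 * posRpow (p.2.2 / γ, -(l2 p.2.1) / lu p.2.1), p.2.1) := by
  have hp' : 0 ≤ p.2.2 := hp
  have hmax : max (p.2.2 / γ) 0 = p.2.2 / γ := max_eq_left (by positivity)
  simp only [DulacMap, posRpow, hmax]
  split_ifs with h
  · rfl
  · have hz : p.2.2 = 0 := le_antisymm (not_lt.mp h) hp'
    have e1 := hdom1 p.2.1
    have e2 := hdom2 p.2.1
    rw [hz, zero_div, Real.zero_rpow (by linarith), Real.zero_rpow (by linarith), mul_zero,
      mul_zero]

/-- Regularity of the Dulac map: under the eigenvalue-domination hypotheses, the Dulac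
map is C¹ on the half-space `H` (derivatives taken within `H`), and at every boundary
point `(x₂,y,0)` its derivative within `H` kills `e_{x₂}` and `e_z` and sends `e_y` to
the third standard basis vector of the target. -/
theorem dulacMap_contDiffOn (l1 l2 lu : ℝ → ℝ)
    (hl1 : ContDiff ℝ 1 l1) (hl2 : ContDiff ℝ 1 l2) (hlu : ContDiff ℝ 1 lu)
    (horder : ∀ y : ℝ, l1 y < l2 y ∧ l2 y < 0 ∧ 0 < lu y)
    (hdom1 : ∀ y : ℝ, 1 < -(l1 y) / lu y) (hdom2 : ∀ y : ℝ, 1 < -(l2 y) / lu y)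
    (γ : ℝ) (hγ : 0 < γ) :
    ContDiffOn ℝ 1 (DulacMap l1 l2 lu γ) DulacHalfSpace ∧
    ∀ x₂ y : ℝ, ∃ L : (ℝ × ℝ × ℝ) →L[ℝ] (ℝ × ℝ × ℝ),
      HasFDerivWithinAt (DulacMap l1 l2 lu γ) L DulacHalfSpace (x₂, y, 0) ∧
      L (1, 0, 0) = 0 ∧ L (0, 0, 1) = 0 ∧ L (0, 1, 0) = (0, 0, 1) := by
  have hlu0 : ∀ y, lu y ≠ 0 := fun y => (horder y).2.2.ne'
  have ha1 : ContDiff ℝ 1 (fun y => -(l1 y) / lu y) := hl1.neg.div hlu hlu0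
  have ha2 : ContDiff ℝ 1 (fun y => -(l2 y) / lu y) := hl2.neg.div hlu hlu0
  have heq := fun (p : ℝ × ℝ × ℝ) (hp : p ∈ DulacHalfSpace) =>
    dulacMap_eq_posRpow hdom1 hdom2 hγ hp
  refine ⟨?_, fun x y => ?_⟩
  · have hc : ContDiff ℝ 1 (fun p : ℝ × ℝ × ℝ =>
        (γ * posRpow (p.2.2 / γ, -(l1 p.2.1) / lu p.2.1),
          p.1 * posRpow (p.2.2 / γ, -(l2 p.2.1) / lu p.2.1), p.2.1)) :=
      (contDiff_const.mul (contDiff_posRpow_comp ha1 hdom1 γ)).prodMk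
        ((contDiff_fst.mul (contDiff_posRpow_comp ha2 hdom2 γ)).prodMk
          (contDiff_fst.comp contDiff_snd))
    exact hc.contDiffOn.congr heq
  · have hd1 := (hasFDerivAt_posRpow_comp ha1 hdom1 γ x y).const_mul γ
    have hd2 := (hasFDerivAt_fst (𝕜 := ℝ) (p := (x, y, (0 : ℝ)))).mul
      (hasFDerivAt_posRpow_comp ha2 hdom2 γ x y)
    have hd3 : HasFDerivAt (fun p : ℝ × ℝ × ℝ => p.2.1)
        ((ContinuousLinearMap.fst ℝ ℝ ℝ).comp (ContinuousLinearMap.snd ℝ ℝ (ℝ × ℝ)))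
        (x, y, 0) :=
      ((ContinuousLinearMap.fst ℝ ℝ ℝ).comp (ContinuousLinearMap.snd ℝ ℝ (ℝ × ℝ))).hasFDerivAt
    have hw : -(l2 y) / lu y ≠ 0 := by linarith [hdom2 y]
    refine ⟨_, ((hd1.prodMk (hd2.prodMk hd3)).hasFDerivWithinAt).congr heq
      (heq _ (le_refl (0 : ℝ))), ?_, ?_, ?_⟩ <;>
    simp [posRpow, Real.zero_rpow hw]
end
end
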